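/- Let $K = \mathbb{F}_p((T))$, let $q = p^f$ with $f \geq 2$, let $b > 0$ be an integer not divisible by $p$, let $\alpha \in K$ with $v_K(\alpha) = -b$, and let $\theta$ be a root of $g(X) = X^q - X - \alpha$. Then $L = K(\theta)$ is a separable extension of $K$ of degree $q$ which is not Galois over $K$. -/

import Mathlib

open Polynomial

lemma aux_exists_val (F E : Type*) [Field F] [Field E] [Algebra (LaurentSeries F) E] :
    ∃ (A : ValuationSubring E) (t : A.ValueGroup), 0 < t ∧ t < 1 ∧
      ∀ x : LaurentSeries F, x ≠ 0 → A.valuation (algebraMap _ E x) = t ^ x.order := by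
  obtain ⟨A, h, hloc⟩ := IsLocalRing.exists_factor_valuationRing
    ((algebraMap (LaurentSeries F) E).comp (HahnSeries.ofPowerSeries ℤ F))
  set φ := (algebraMap (LaurentSeries F) E).comp (HahnSeries.ofPowerSeries ℤ F) with hφ
  have hX : A.valuation (φ PowerSeries.X) < 1 := by
    have h1 : ¬ IsUnit (⟨φ PowerSeries.X, h _⟩ : A) := by
      intro hu
      have := hloc.map_nonunit PowerSeries.X hu
      exact PowerSeries.X_prime.not_isUnit this
    have := (A.valuation_lt_one_iff ⟨φ PowerSeries.X, h _⟩).1 ((IsLocalRing.mem_maximalIdeal _).2 h1)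
    exact this
  have hU : ∀ u : PowerSeries F, IsUnit u → A.valuation (φ u) = 1 := by
    intro u hu
    exact (A.valuation_eq_one_iff ⟨φ u, h u⟩).1 (hu.map (φ.codRestrict A.toSubring h))
  have hXe : φ PowerSeries.X = algebraMap (LaurentSeries F) E (HahnSeries.single 1 1) := by
    simp [hφ]
  refine ⟨A, A.valuation (φ PowerSeries.X), ?_, hX, ?_⟩
  · rw [zero_lt_iff, Valuation.ne_zero_iff, hXe]
    simp
  · intro x hx
    have hu : IsUnit x.powerSeriesPart := by
      rw [PowerSeries.isUnit_iff_constantCoeff, isUnit_iff_ne_zero,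
        ← PowerSeries.coeff_zero_eq_constantCoeff_apply, LaurentSeries.powerSeriesPart_coeff]
      simpa using hx
    have h1 := hU _ hu
    conv_lhs => rw [← LaurentSeries.single_order_mul_powerSeriesPart x]
    rw [map_mul, map_mul]
    have h2 : algebraMap (LaurentSeries F) E (HahnSeries.ofPowerSeries ℤ F x.powerSeriesPart)
      = φ x.powerSeriesPart := rfl
    rw [h2, h1, mul_one, RatFunc.single_zpow, map_zpow₀, map_zpow₀, hXe]

section
variable {E Γ : Type*} [Field E] [LinearOrderedCommGroupWithZero Γ] 

lemma aux_theta {F : Type*} [Field F] [Algebra (LaurentSeries F) E] (v : Valuation E Γ) (t : Γ) (ht0 : 0 < t) (ht1 : t < 1)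
    (hv : ∀ x : LaurentSeries F, x ≠ 0 → v (algebraMap _ E x) = t ^ x.order)
    (q : ℕ) (hq : 2 ≤ q) (b : ℤ) (hb : 0 < b) (α : LaurentSeries F) (hα0 : α ≠ 0)
    (hα : α.order = -b) (θ : E) (hθ : θ ^ q - θ = algebraMap _ E α) :
    v θ ^ q = t ^ (-b) := by
  have h1 : v (θ ^ q - θ) = t ^ (-b) := by rw [hθ, hv α hα0, hα]
  have h2 : 1 < t ^ (-b) := by
    rw [zpow_neg]
    exact (one_lt_inv₀ (zpow_pos ht0 _)).2 (zpow_lt_one₀ ht0 ht1 hb)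
  have h3 : 1 < v θ := by
    by_contra hc
    push Not at hc
    rw [← h1] at h2
    refine absurd h2 (not_lt.2 (v.map_sub_le ?_ hc))
    rw [map_pow]
    exact pow_le_one₀ zero_le hc
  rw [← h1, v.map_sub_eq_of_lt_left, map_pow]
  rw [map_pow]
  exact lt_self_pow₀ h3 (by omega)

lemma aux_pow {F : Type*} [Field F] [Algebra (LaurentSeries F) E] (v : Valuation E Γ) (t : Γ) 
    (ht0 : 0 < t)
    (hv : ∀ x : LaurentSeries F, x ≠ 0 → v (algebraMap _ E x) = t ^ x.order)
    (q : ℕ) (b : ℤ) (θ : E) (hθ : v θ ^ q = t ^ (-b)) (x : LaurentSeries F) (hx : x ≠ 0) (i : ℕ) :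
    v (algebraMap _ E x * θ ^ i) ^ q = t ^ (q * x.order - b * i) := by
  rw [map_mul, hv x hx, map_pow, mul_pow, ← pow_mul, mul_comm i q, pow_mul, hθ,
    ← zpow_natCast (t ^ (x.order)), ← zpow_natCast (t ^ (-b)), ← zpow_mul, ← zpow_mul,
    ← zpow_add₀ ht0.ne']
  congr 1
  ring

lemma aux_sum {F : Type*} [Field F] [Algebra (LaurentSeries F) E] (v : Valuation E Γ) (t : Γ) 
    (ht0 : 0 < t) (ht1 : t < 1)
    (hv : ∀ x : LaurentSeries F, x ≠ 0 → v (algebraMap _ E x) = t ^ x.order)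
    (q : ℕ) (b : ℤ) (hqb : IsCoprime (q : ℤ) b) (θ : E) (hθ : v θ ^ q = t ^ (-b))
    (c : ℕ → LaurentSeries F) (i : ℕ) (hi : i ∈ Finset.range q) :
    v (algebraMap _ E (c i) * θ ^ i) ≤
      v (∑ j ∈ Finset.range q, algebraMap _ E (c j) * θ ^ j) := by
  obtain ⟨m, hm, hmax⟩ := Finset.exists_max_image (Finset.range q)
    (fun j => v (algebraMap _ E (c j) * θ ^ j)) ⟨i, hi⟩
  by_cases h0 : v (algebraMap _ E (c m) * θ ^ m) = 0
  · have := hmax i hi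
    simp only [h0] at this
    exact this.trans zero_le
  have hcm : c m ≠ 0 := by
    intro h; simp [h] at h0
  rw [v.map_sum_eq_of_lt hm]
  · exact hmax i hi
  intro j hj
  rw [Finset.mem_sdiff, Finset.mem_singleton] at hj
  refine lt_of_le_of_ne (hmax j hj.1) fun he => ?_
  have hcj : c j ≠ 0 := by
    intro h; rw [← he] at h0; simp [h] at h0
  have h1 := aux_pow v t ht0 hv q b θ hθ (c m) hcm m
  have h2 := aux_pow v t ht0 hv q b θ hθ (c j) hcj j
  rw [he, h1] at h2
  have h3 := zpow_right_injective₀ ht0 ht1.ne h2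
  have h4 : (q : ℤ) ∣ b * ((m : ℤ) - j) := ⟨(c m).order - (c j).order, by linear_combination -h3⟩
  have h5 := hqb.dvd_of_dvd_mul_left h4
  have hmq := Finset.mem_range.1 hm
  have hjq := Finset.mem_range.1 hj.1
  have h6 := Int.eq_zero_of_abs_lt_dvd h5 (by rw [abs_lt]; omega)
  exact hj.2 (by omega)
end

lemma aux_residue {F E Γ : Type*} [Field F] [Field E] [LinearOrderedCommGroupWithZero Γ]
    [Algebra (LaurentSeries F) E] (v : Valuation E Γ) (t : Γ)
    (ht0 : 0 < t) (ht1 : t < 1)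
    (hv : ∀ x : LaurentSeries F, x ≠ 0 → v (algebraMap _ E x) = t ^ x.order)
    (c : LaurentSeries F) (hc : v (algebraMap _ E c) ≤ 1) :
    ∃ a : F, v (algebraMap _ E (c - HahnSeries.C a)) < 1 := by
  by_cases hc0 : c = 0
  · exact ⟨0, by simp [hc0]⟩
  refine ⟨c.coeff 0, ?_⟩
  rw [hv c hc0] at hc
  have ho : 0 ≤ c.order := by
    by_contra h
    push Not at h
    exact absurd hc (not_le.2 (one_lt_zpow_of_neg₀ ht0 ht1 h))
  by_cases hd : c - HahnSeries.C (c.coeff 0) = 0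
  · rw [hd]; simp
  rw [hv _ hd]
  refine zpow_lt_one₀ ht0 ht1 ?_
  by_contra h
  push Not at h
  refine hd (HahnSeries.coeff_order_eq_zero.1 ?_)
  set n := (c - HahnSeries.C (c.coeff 0)).order
  rw [HahnSeries.coeff_sub, HahnSeries.C_apply]
  rcases h.eq_or_lt with h | h
  · rw [h]; simp
  · rw [HahnSeries.coeff_single_of_ne h.ne, HahnSeries.coeff_eq_zero_of_lt_order (by omega)]
    simp

lemma aux_omega (p : ℕ) [Fact p.Prime] (f : ℕ) (hf : 2 ≤ f) (E : Type*) [Field E] [IsAlgClosed E]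
    [CharP E p] (φ : ZMod p →+* E) : ∃ ω : E, ω ^ p ^ f = ω ∧ ω ∉ Set.range φ := by
  classical
  have hp : p.Prime := Fact.out
  have hsep := galois_poly_separable (K := E) p (p ^ f) (dvd_pow_self p (by omega))
  have hcard := card_rootSet_eq_natDegree (K := E) hsep (IsAlgClosed.splits _)
  have hlt : p < p ^ f := by
    calc p = p ^ 1 := (pow_one p).symm
      _ < p ^ f := Nat.pow_lt_pow_right hp.one_lt (by omega)
  rw [FiniteField.X_pow_card_sub_X_natDegree_eq E (hp.one_lt.trans hlt)] at hcard
  by_contra! hcon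
  have hsub : (X ^ p ^ f - X : E[X]).rootSet E ⊆ Set.range φ := by
    intro x hx
    have := Polynomial.aeval_eq_zero_of_mem_rootSet hx
    refine hcon x ?_
    simpa [sub_eq_zero] using this
  have h1 := Set.ncard_le_ncard hsub (Set.finite_range φ)
  rw [← Nat.card_coe_set_eq, Nat.card_eq_fintype_card, hcard, Set.ncard_eq_toFinset_card',
    Set.toFinset_range] at h1
  have h2 := (Finset.card_image_le (s := Finset.univ) (f := φ))
  rw [Finset.card_univ, ZMod.card] at h2
  omega

theorem aux_core (p : ℕ) [Fact p.Prime] (f : ℕ) (hf : 2 ≤ f) (q : ℕ) (hq : q = p ^ f)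
    (b : ℤ) (hb : 0 < b) (hpb : ¬ (p : ℤ) ∣ b)
    (α : LaurentSeries (ZMod p)) (hα0 : α ≠ 0) (hα : α.order = -b)
    {E : Type*} [Field E] [IsAlgClosed E] [Algebra (LaurentSeries (ZMod p)) E] (θ : E)
    (hθ : θ ^ q - θ = algebraMap (LaurentSeries (ZMod p)) E α) :
    Algebra.IsSeparable (LaurentSeries (ZMod p)) (IntermediateField.adjoin (LaurentSeries (ZMod p)) {θ}) ∧
    Module.finrank (LaurentSeries (ZMod p)) (IntermediateField.adjoin (LaurentSeries (ZMod p)) {θ}) = q ∧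
    ¬ IsGalois (LaurentSeries (ZMod p)) (IntermediateField.adjoin (LaurentSeries (ZMod p)) {θ}) := by
  have hp : p.Prime := Fact.out
  have hq2 : 2 ≤ q := by
    rw [hq]
    calc 2 ≤ p := hp.two_le
      _ = p ^ 1 := (pow_one p).symm
      _ ≤ p ^ f := Nat.pow_le_pow_right hp.pos (by omega)
  have hqb : IsCoprime (q : ℤ) b := by
    rw [hq]
    push_cast
    exact ((Nat.prime_iff_prime_int.1 hp).coprime_iff_not_dvd.2 hpb).pow_left
  let φK : ZMod p →+* LaurentSeries (ZMod p) := HahnSeries.C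
  let φ : ZMod p →+* E := (algebraMap (LaurentSeries (ZMod p)) E).comp φK
  have : CharP (LaurentSeries (ZMod p)) p := charP_of_injective_ringHom φK.injective p
  have : CharP E p := charP_of_injective_ringHom φ.injective p
  obtain ⟨A, t, ht0, ht1, hv⟩ := aux_exists_val (ZMod p) E
  set v := A.valuation
  have hvθ := aux_theta v t ht0 ht1 hv q hq2 b hb α hα0 hα θ hθ
  have hsum := aux_sum v t ht0 ht1 hv q b hqb θ hvθ
  -- the polynomial
  set g : (LaurentSeries (ZMod p))[X] := X ^ q - (X + C α) with hg
  have hdeg : (X + C α : (LaurentSeries (ZMod p))[X]).degree < q := by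
    rw [degree_X_add_C]; exact_mod_cast hq2
  have hgm : g.Monic := monic_X_pow_sub (by
    rw [degree_X_add_C]; exact_mod_cast hq2)
  have hgd : g.natDegree = q := by
    rw [hg, natDegree_sub_eq_left_of_natDegree_lt]
    · simp
    · rw [natDegree_X_add_C, natDegree_X_pow]; omega
  have hg0 : aeval θ g = 0 := by
    simp [hg, ← hθ]
  have hgs : g.Separable := by
    have h1 : derivative g = -1 := by
      have : ((q : ℕ) : LaurentSeries (ZMod p)) = 0 := by
        rw [CharP.cast_eq_zero_iff _ p, hq]
        exact dvd_pow_self p (by omega)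
      simp [hg, derivative_X_pow, this]
    rw [separable_def, h1]
    exact isCoprime_one_right.neg_right
  have hint : IsIntegral (LaurentSeries (ZMod p)) θ := ⟨g, hgm, by rw [← aeval_def]; exact hg0⟩
  have hdvd : minpoly (LaurentSeries (ZMod p)) θ ∣ g := minpoly.dvd _ _ hg0
  have hev : ∀ P : (LaurentSeries (ZMod p))[X], P.natDegree < q →
      aeval θ P = ∑ j ∈ Finset.range q, algebraMap _ E (P.coeff j) * θ ^ j := by
    intro P hP
    rw [aeval_eq_sum_range' hP]
    simp [Algebra.smul_def]
  have hθ0 : θ ≠ 0 := by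
    rintro rfl
    rw [map_zero, zero_pow (by omega)] at hvθ
    exact (zpow_pos ht0 _).ne hvθ
  have hmin : (minpoly (LaurentSeries (ZMod p)) θ).natDegree = q := by
    refine le_antisymm (hgd ▸ natDegree_le_of_dvd hdvd hgm.ne_zero) ?_
    by_contra hlt
    push Not at hlt
    have h1 := hev _ hlt
    rw [minpoly.aeval] at h1
    have h2 := hsum (minpoly (LaurentSeries (ZMod p)) θ).coeff _ (Finset.mem_range.2 hlt)
    rw [← h1, map_zero, le_zero_iff, Valuation.zero_iff, coeff_natDegree,
      (minpoly.monic hint).leadingCoeff] at h2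
    simp [hθ0] at h2
  have hming : minpoly (LaurentSeries (ZMod p)) θ = g := Eq.symm <|
    (eq_of_monic_of_dvd_of_natDegree_le (minpoly.monic hint) hgm hdvd (by rw [hmin, hgd]))
  refine ⟨?_, ?_, ?_⟩
  · rw [IntermediateField.isSeparable_adjoin_simple_iff_isSeparable]
    show (minpoly _ θ).Separable
    rwa [hming]
  · rw [IntermediateField.adjoin.finrank hint, hmin]
  · intro hgal
    obtain ⟨ω, hω, hωr⟩ := aux_omega p f hf E φ
    rw [← hq] at hω
    have hsub : ∀ x y : E, (x - y) ^ q = x ^ q - y ^ q := by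
      intro x y; rw [hq]; exact sub_pow_char_pow x y f
    have hadd : ∀ x y : E, (x + y) ^ q = x ^ q + y ^ q := by
      intro x y; rw [hq]; exact add_pow_char_pow x y p f
    have hmemθ := IntermediateField.mem_adjoin_simple_self (LaurentSeries (ZMod p)) θ
    have hnorm := hgal.to_normal.splits
      (⟨θ, hmemθ⟩ : IntermediateField.adjoin (LaurentSeries (ZMod p)) {θ})
    have hmg : minpoly (LaurentSeries (ZMod p))
      (⟨θ, hmemθ⟩ : IntermediateField.adjoin (LaurentSeries (ZMod p)) {θ}) = g := by
      rw [← hming]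
      exact IntermediateField.minpoly_eq _
    rw [hmg, IntermediateField.splits_iff_mem (IsAlgClosed.splits _)] at hnorm
    have h1 := hnorm (θ + ω) (by
      rw [mem_rootSet]
      refine ⟨hgm.ne_zero, ?_⟩
      simp only [hg, map_sub, map_add, map_pow, aeval_X, aeval_C, hadd, hω, ← hθ]
      ring)
    have h2 : ω ∈ IntermediateField.adjoin (LaurentSeries (ZMod p)) {θ} := by
      have := sub_mem h1 hmemθ
      rwa [add_sub_cancel_left] at this
    rw [← IntermediateField.mem_toSubalgebra,
      IntermediateField.adjoin_simple_toSubalgebra_of_isAlgebraic hint.isAlgebraic,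
      Algebra.adjoin_singleton_eq_range_aeval] at h2
    obtain ⟨P, hP⟩ := h2
    replace hP : aeval θ P = ω := hP
    rw [← aeval_modByMonic_eq_self_of_root hg0, hev (P %ₘ g) (by
      have := natDegree_modByMonic_lt P hgm (by intro h; rw [h, natDegree_one] at hgd; omega)
      rwa [hgd] at this)] at hP
    set c := (P %ₘ g).coeff
    have hroot : ∀ x : E, x ^ q = x → x ≠ 0 → v x = 1 := by
      intro x hx hx0
      have h3 : v x ^ q = v x := by rw [← map_pow, hx]
      have h4 : v x ^ (q - 1) = 1 := by
        have h5 : v x ^ (q - 1) * v x = 1 * v x := by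
          rw [← pow_succ, one_mul, Nat.sub_add_cancel (by omega), h3]
        exact mul_right_cancel₀ ((Valuation.ne_zero_iff v).2 hx0) h5
      exact (pow_eq_one_iff_of_nonneg zero_le (by omega)).1 h4
    have hω0 : ω ≠ 0 := by
      rintro rfl
      exact hωr ⟨0, map_zero _⟩
    have hvω := hroot ω hω hω0
    have hle : ∀ i ∈ Finset.range q, v (algebraMap _ E (c i) * θ ^ i) ≤ 1 := by
      intro i hi
      have := hsum c i hi
      rwa [hP, hvω] at this
    have hc0 : v (algebraMap _ E (c 0)) ≤ 1 := by
      simpa using hle 0 (Finset.mem_range.2 (by omega))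
    obtain ⟨a, ha⟩ := aux_residue v t ht0 ht1 hv (c 0) hc0
    obtain ⟨r, rfl⟩ : ∃ r, q = r + 1 := ⟨q - 1, by omega⟩
    rw [Finset.sum_range_succ'] at hP
    have hrest : v (∑ k ∈ Finset.range r, algebraMap _ E (c (k + 1)) * θ ^ (k + 1)) < 1 := by
      refine v.map_sum_lt one_ne_zero fun k hk => ?_
      have hk' := Finset.mem_range.1 hk
      refine lt_of_le_of_ne (hle (k + 1) (Finset.mem_range.2 (by omega))) fun he => ?_
      have hck : c (k + 1) ≠ 0 := by
        intro h; rw [h] at he; simp at he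
      have h3 := aux_pow v t ht0 hv (r + 1) b θ hvθ (c (k + 1)) hck (k + 1)
      rw [he, one_pow, ← zpow_zero t] at h3
      have h4 := zpow_right_injective₀ ht0 ht1.ne h3
      have h5 : ((r + 1 : ℕ) : ℤ) ∣ b * ((k + 1 : ℕ) : ℤ) :=
        ⟨(c (k + 1)).order, by linear_combination h4⟩
      have h6 := Int.le_of_dvd (by omega) (hqb.dvd_of_dvd_mul_left h5)
      omega
    have hfin : v (ω - φ a) < 1 := by
      have : ω - φ a = (∑ k ∈ Finset.range r, algebraMap _ E (c (k + 1)) * θ ^ (k + 1))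
          + algebraMap _ E (c 0 - HahnSeries.C a) := by
        rw [← hP, map_sub]
        simp only [φ, φK, RingHom.comp_apply, pow_zero, mul_one]
        ring
      rw [this]
      exact v.map_add_lt hrest ha
    refine hfin.ne (hroot _ ?_ ?_)
    · rw [hsub, hω, ← map_pow]
      congr 2
      rw [hq]
      exact ZMod.pow_card_pow a
    · rw [sub_ne_zero]
      rintro h
      exact hωr ⟨a, h.symm⟩

/-- Let `K = 𝔽_p((T))` be the field of formal Laurent series over `𝔽_p`, let
`q = p ^ f` with `f ≥ 2`, let `b > 0` be an integer not divisible by `p`, let `α ∈ K` with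
`v_K(α) = -b` (i.e. `α` is a nonzero Laurent series of order `-b`), and let `θ` (in an
algebraic closure of `K`) be a root of `g(X) = X ^ q - X - α`. Then `L = K(θ)` is a
separable extension of `K` of degree `q` which is not Galois over `K`. -/
theorem stmt_16 (p : ℕ) [Fact p.Prime] (f : ℕ) (hf : 2 ≤ f) (q : ℕ) (hq : q = p ^ f)
    (b : ℤ) (hb : 0 < b) (hpb : ¬ (p : ℤ) ∣ b)
    (α : LaurentSeries (ZMod p)) (hα0 : α ≠ 0) (hα : α.order = -b)
    (θ : AlgebraicClosure (LaurentSeries (ZMod p)))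
    (hθ : θ ^ q - θ = algebraMap (LaurentSeries (ZMod p)) (AlgebraicClosure (LaurentSeries (ZMod p))) α)
    (L : IntermediateField (LaurentSeries (ZMod p)) (AlgebraicClosure (LaurentSeries (ZMod p))))
    (hL : L = IntermediateField.adjoin (LaurentSeries (ZMod p)) {θ}) :
    Algebra.IsSeparable (LaurentSeries (ZMod p)) L ∧
    Module.finrank (LaurentSeries (ZMod p)) L = q ∧
    ¬ IsGalois (LaurentSeries (ZMod p)) L := by
  subst hL
  exact aux_core p f hf q hq b hb hpb α hα0 hα θ hθ
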